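/- arXiv:2009.00654 — 2 statements merged into one kernel-verified Lean document; each statement's English description precedes it below -/
import Mathlib

section
/- The Diophantine equation z^2 = x^4 + 10x^2y^2 + 9y^4 has no solutions in positive integers x, y, z. -/
lemma aux_sq8 (k : ℤ) (hk : k % 2 = 1) : ∃ s, k ^ 2 = 8 * s + 1 := by
  obtain ⟨s, hs⟩ := Int.eight_dvd_sq_sub_one_of_odd (Int.odd_iff.mpr hk)
  exact ⟨s, by linarith⟩

lemma aux_sq_even (k : ℤ) (hk : k % 2 = 0) : ∃ s, k ^ 2 = 4 * s ∧ (s % 8 = 0 ∨ s % 8 = 1 ∨ s % 8 = 4) := by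
  obtain ⟨t, rfl⟩ : ∃ t, k = 2 * t := ⟨k / 2, by omega⟩
  refine ⟨t ^ 2, by ring, ?_⟩
  have h : t % 8 = 0 ∨ t % 8 = 1 ∨ t % 8 = 2 ∨ t % 8 = 3 ∨ t % 8 = 4 ∨ t % 8 = 5 ∨ t % 8 = 6 ∨ t % 8 = 7 := by omega
  rcases h with h | h | h | h | h | h | h | h <;> simp [pow_two, Int.mul_emod, h]

lemma aux_sq3 (k : ℤ) (hk : ¬ (3 : ℤ) ∣ k) : ∃ s, k ^ 2 = 3 * s + 1 := by
  have h : k % 3 = 1 ∨ k % 3 = 2 := by omega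
  refine ⟨k ^ 2 / 3, ?_⟩
  have : k ^ 2 % 3 = 1 := by
    rcases h with h | h <;> simp [pow_two, Int.mul_emod, h]
  omega

/-- four number lemma -/
lemma aux_four (m n p q : ℤ) (hm : m ≠ 0) (h : m * n = p * q) :
    ∃ a b c d : ℤ, m = a * b ∧ n = c * d ∧ p = a * c ∧ q = b * d := by
  obtain ⟨a, b, ⟨c, hc⟩, ⟨d, hd⟩, hab⟩ := exists_dvd_and_dvd_of_dvd_mul (Dvd.intro n h)
  refine ⟨a, b, c, d, hab, ?_, hc, hd⟩
  apply mul_left_cancel₀ hm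
  rw [h, hc, hd, hab]; ring

lemma aux_cop (m n a b c d : ℤ) (h : IsCoprime m n) (hm : m = a * b) (hn : n = c * d) :
    IsCoprime a d ∧ IsCoprime b c ∧ IsCoprime a c ∧ IsCoprime b d := by
  subst hm hn
  exact ⟨h.of_mul_left_left.of_mul_right_right, h.of_mul_left_right.of_mul_right_left,
    h.of_mul_left_left.of_mul_right_left, h.of_mul_left_right.of_mul_right_right⟩

lemma not_both_even (a b : ℤ) (h : IsCoprime a b) (ha : a % 2 = 0) (hb : b % 2 = 0) : False := by
  have := h.isUnit_of_dvd' (Int.dvd_of_emod_eq_zero ha) (Int.dvd_of_emod_eq_zero hb)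
  rw [Int.isUnit_iff] at this
  omega

lemma core (a b c d : ℤ) (had : IsCoprime a d) (hbc : IsCoprime b c) (hb0 : b ≠ 0)
    (h3a : ¬ (3 : ℤ) ∣ a) (h3c : ¬ (3 : ℤ) ∣ c)
    (h : a ^ 2 * (b ^ 2 - c ^ 2) = d ^ 2 * (c ^ 2 - 9 * b ^ 2)) :
    b ^ 2 = a ^ 2 + d ^ 2 ∧ c ^ 2 = a ^ 2 + 9 * d ^ 2 := by
  have ha0 : a ≠ 0 := by rintro rfl; simp at h3a
  have hdvd : a ^ 2 ∣ c ^ 2 - 9 * b ^ 2 := by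
    have h1 : a ^ 2 ∣ d ^ 2 * (c ^ 2 - 9 * b ^ 2) := Dvd.intro _ h
    exact (IsCoprime.pow had).dvd_of_dvd_mul_left h1
  obtain ⟨k, hk⟩ := hdvd
  have hk2 : b ^ 2 - c ^ 2 = d ^ 2 * k := by
    have : a ^ 2 ≠ 0 := pow_ne_zero _ ha0
    apply mul_left_cancel₀ this
    rw [h, hk]; ring
  have e1 : -8 * b ^ 2 = k * (a ^ 2 + d ^ 2) := by linear_combination hk + hk2
  have e2 : -8 * c ^ 2 = k * (a ^ 2 + 9 * d ^ 2) := by linear_combination hk + 9 * hk2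
  have hk8 : k ∣ 8 := by
    obtain ⟨u, v, huv⟩ := (IsCoprime.pow hbc : IsCoprime (b ^ 2) (c ^ 2))
    refine ⟨-(u * (a ^ 2 + d ^ 2) + v * (a ^ 2 + 9 * d ^ 2)), ?_⟩
    linear_combination (-8) * huv - u * e1 - v * e2
  have hneg : k < 0 := by
    by_contra hh
    have : 0 < b ^ 2 := by positivity
    have : 0 ≤ k * (a ^ 2 + d ^ 2) := mul_nonneg (by linarith) (by positivity)
    linarith
  have hge : -8 ≤ k := by
    have := Int.le_of_dvd (by norm_num) ((neg_dvd).mpr hk8)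
    linarith
  obtain ⟨s, hs⟩ := aux_sq3 a h3a
  obtain ⟨t, ht⟩ := aux_sq3 c h3c
  have hcases : k = -2 ∨ k = -8 := by
    rw [hs, ht] at hk
    interval_cases k <;> first | omega | (exfalso; revert hk8; decide)
  rcases hcases with rfl | rfl
  · exfalso
    have hb : b % 2 = 0 ∨ b % 2 = 1 := by omega
    have hc : c % 2 = 0 ∨ c % 2 = 1 := by omega
    have ha : a % 2 = 0 ∨ a % 2 = 1 := by omega
    have hd : d % 2 = 0 ∨ d % 2 = 1 := by omega
    rcases hb with hb | hb <;> rcases hc with hc | hc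
    · exact not_both_even b c hbc hb hc
    · obtain ⟨s1, h1, -⟩ := aux_sq_even b hb
      obtain ⟨s2, h2⟩ := aux_sq8 c hc
      omega
    · obtain ⟨s1, h1, -⟩ := aux_sq_even c hc
      obtain ⟨s2, h2⟩ := aux_sq8 b hb
      omega
    · obtain ⟨s1, h1⟩ := aux_sq8 c hc
      obtain ⟨s2, h2⟩ := aux_sq8 b hb
      rcases ha with ha | ha
      · rcases hd with hd | hd
        · exact not_both_even a d had ha hd
        · obtain ⟨s3, h3⟩ := aux_sq8 d hd
          omega
      · obtain ⟨s3, h3⟩ := aux_sq8 a ha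
        omega
  · constructor <;> linarith

lemma caseB (a b c d : ℤ)
    (h1 : (a * b) % 2 = 0 ∧ (c * d) % 2 = 1 ∨ (a * b) % 2 = 1 ∧ (c * d) % 2 = 0)
    (h2 : (a * c) % 2 = 0 ∧ (b * d) % 2 = 1 ∨ (a * c) % 2 = 1 ∧ (b * d) % 2 = 0)
    (h : 3 * ((a * b) ^ 2 - (c * d) ^ 2) = (a * c) ^ 2 - (b * d) ^ 2) : False := by
  have h' : a ^ 2 * (3 * b ^ 2 - c ^ 2) = d ^ 2 * (3 * c ^ 2 - b ^ 2) := by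
    linear_combination h
  have ha : a % 2 = 0 ∨ a % 2 = 1 := by omega
  have hb : b % 2 = 0 ∨ b % 2 = 1 := by omega
  have hc : c % 2 = 0 ∨ c % 2 = 1 := by omega
  have hd : d % 2 = 0 ∨ d % 2 = 1 := by omega
  rcases ha with ha | ha <;> rcases hb with hb | hb <;> rcases hc with hc | hc <;>
    rcases hd with hd | hd <;> simp [Int.mul_emod, ha, hb, hc, hd] at h1 h2
  · obtain ⟨s, hs, -⟩ := aux_sq_even a ha
    obtain ⟨t, ht⟩ := aux_sq8 b hb
    obtain ⟨u, hu⟩ := aux_sq8 c hc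
    obtain ⟨v, hv⟩ := aux_sq8 d hd
    rw [hs, ht, hu, hv] at h'
    ring_nf at h'
    omega
  · obtain ⟨s, hs⟩ := aux_sq8 a ha
    obtain ⟨t, ht, -⟩ := aux_sq_even b hb
    obtain ⟨u, hu⟩ := aux_sq8 c hc
    obtain ⟨v, hv⟩ := aux_sq8 d hd
    rw [hs, ht, hu, hv] at h'
    ring_nf at h'
    omega
  · obtain ⟨s, hs⟩ := aux_sq8 a ha
    obtain ⟨t, ht⟩ := aux_sq8 b hb
    obtain ⟨u, hu, -⟩ := aux_sq_even c hc
    obtain ⟨v, hv⟩ := aux_sq8 d hd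
    rw [hs, ht, hu, hv] at h'
    ring_nf at h'
    omega
  · obtain ⟨s, hs⟩ := aux_sq8 a ha
    obtain ⟨t, ht⟩ := aux_sq8 b hb
    obtain ⟨u, hu⟩ := aux_sq8 c hc
    obtain ⟨v, hv, -⟩ := aux_sq_even d hd
    rw [hs, ht, hu, hv] at h'
    ring_nf at h'
    omega

/-- the bookkeeping of sizes in the descent -/
lemma size_lt (x a b c d : ℤ) (hx : 0 < x) (h : a * b * (c * d) ≠ 0) (e : ℤ)
    (he : e = 2 * (a * b) * (c * d)) (hy : 0 < e) :
    0 < |a| ∧ 0 < |d| ∧ |a| * |d| < x * e := by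
  have ha : a ≠ 0 := by rintro rfl; simp at h
  have hb : b ≠ 0 := by rintro rfl; simp at h
  have hc : c ≠ 0 := by rintro rfl; simp at h
  have hd : d ≠ 0 := by rintro rfl; simp at h
  refine ⟨abs_pos.mpr ha, abs_pos.mpr hd, ?_⟩
  have e1 : e = 2 * (|a| * |d|) * (|b| * |c|) := by
    rw [← abs_of_pos hy, he]
    simp only [abs_mul, abs_two]; ring
  have h1 : 0 < |a| * |d| := mul_pos (abs_pos.mpr ha) (abs_pos.mpr hd)
  have h2 : 0 < |b| * |c| := mul_pos (abs_pos.mpr hb) (abs_pos.mpr hc)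
  have : |a| * |d| < e := by rw [e1]; nlinarith
  nlinarith

lemma descent (N : ℕ) : ∀ x y z : ℤ, 0 < x → 0 < y → x * y ≤ N →
    z ^ 2 = (x ^ 2 + y ^ 2) * (x ^ 2 + 9 * y ^ 2) → False := by
  induction N with
  | zero =>
    intro x y z hx hy h _
    have := mul_pos hx hy
    push_cast at h
    linarith
  | succ N ih =>
    intro x y z hx hy hN hz
    push_cast at hN
    -- any smaller solution is contradictory
    have small : ∀ x' y' z' : ℤ, 0 < x' → 0 < y' → x' * y' < x * y →
        z' ^ 2 = (x' ^ 2 + y' ^ 2) * (x' ^ 2 + 9 * y' ^ 2) → False := by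
      intro x' y' z' h1 h2 h3 h4
      exact ih x' y' z' h1 h2 (by linarith) h4
    -- coprimality
    have hcop : IsCoprime x y := by
      rw [Int.isCoprime_iff_gcd_eq_one]
      by_contra hg
      have hgpos : 0 < Int.gcd x y := Int.gcd_pos_of_ne_zero_left _ hx.ne'
      have hg2 : (2 : ℤ) ≤ (Int.gcd x y : ℤ) := by
        have : 2 ≤ Int.gcd x y := by omega
        exact_mod_cast this
      obtain ⟨u, hu⟩ := Int.gcd_dvd_left x y
      obtain ⟨v, hv⟩ := Int.gcd_dvd_right x y
      generalize ((Int.gcd x y : ℕ) : ℤ) = g at *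
      have hzd : g ^ 2 ∣ z := by
        rw [← Int.pow_dvd_pow_iff (n := 2) (by norm_num)]
        exact ⟨(u ^ 2 + v ^ 2) * (u ^ 2 + 9 * v ^ 2), by rw [hz, hu, hv]; ring⟩
      obtain ⟨w, hw⟩ := hzd
      have hu0 : 0 < u := by
        rw [hu] at hx; exact pos_of_mul_pos_right hx (by linarith)
      have hv0 : 0 < v := by
        rw [hv] at hy; exact pos_of_mul_pos_right hy (by linarith)
      refine small u v w hu0 hv0 ?_ ?_
      · have := mul_pos hu0 hv0
        rw [hu, hv]
        nlinarith [mul_pos hu0 hv0, mul_le_mul hg2 hg2 (by norm_num) (by linarith)]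
      · have : (g ^ 4) ≠ 0 := by positivity
        apply mul_left_cancel₀ this
        rw [hw, hu, hv] at hz
        linear_combination hz
    -- 3 does not divide x
    have h3x : ¬ (3 : ℤ) ∣ x := by
      rintro ⟨w, rfl⟩
      have hzd : (3 : ℤ) ∣ z := by
        apply Int.Prime.dvd_pow' (n := z) (k := 2) (p := 3) (by norm_num)
        exact ⟨3 * ((y ^ 2 + w ^ 2) * (y ^ 2 + 9 * w ^ 2)), by rw [hz]; push_cast; ring⟩
      obtain ⟨t, rfl⟩ := hzd
      refine small y w t hy (by linarith) (by nlinarith) ?_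
      linarith
    have hx2 : x % 2 = 0 ∨ x % 2 = 1 := by omega
    have hy2 : y % 2 = 0 ∨ y % 2 = 1 := by omega
    -- opposite parity
    have hpar : x % 2 = 0 ∧ y % 2 = 1 ∨ x % 2 = 1 ∧ y % 2 = 0 := by
      rcases hx2 with hx2 | hx2 <;> rcases hy2 with hy2 | hy2
      · exact (not_both_even x y hcop hx2 hy2).elim
      · exact Or.inl ⟨hx2, hy2⟩
      · exact Or.inr ⟨hx2, hy2⟩
      · exfalso
        obtain ⟨s, hs⟩ := aux_sq8 x hx2
        obtain ⟨t, ht⟩ := aux_sq8 y hy2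
        rw [hs, ht] at hz
        ring_nf at hz
        have hz2 : z % 2 = 0 ∨ z % 2 = 1 := by omega
        rcases hz2 with hz2 | hz2
        · obtain ⟨r, hr, hr'⟩ := aux_sq_even z hz2
          omega
        · obtain ⟨r, hr⟩ := aux_sq8 z hz2
          omega
    -- both factors are squares
    have hcop2 : IsCoprime (x ^ 2 + y ^ 2) (x ^ 2 + 9 * y ^ 2) := by
      have hodd : IsCoprime (x ^ 2 + y ^ 2) 2 := by
        have : ∃ s, x ^ 2 + y ^ 2 = 2 * s + 1 := by
          rcases hpar with ⟨h1, h2⟩ | ⟨h1, h2⟩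
          · obtain ⟨s, hs, -⟩ := aux_sq_even x h1
            obtain ⟨t, ht⟩ := aux_sq8 y h2
            exact ⟨2 * s + 4 * t, by linarith⟩
          · obtain ⟨s, hs, -⟩ := aux_sq_even y h2
            obtain ⟨t, ht⟩ := aux_sq8 x h1
            exact ⟨2 * s + 4 * t, by linarith⟩
        obtain ⟨s, hs⟩ := this
        exact ⟨1, -s, by linarith⟩
      have h8 : IsCoprime (x ^ 2 + y ^ 2) 8 := by
        have := hodd.pow_right (n := 3)
        norm_num at this
        exact this
      have hyy : IsCoprime (x ^ 2 + y ^ 2) (y ^ 2) := by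
        obtain ⟨u, v, huv⟩ := (IsCoprime.pow hcop : IsCoprime (x ^ 2) (y ^ 2))
        exact ⟨u, v - u, by linear_combination huv⟩
      obtain ⟨u, v, huv⟩ := h8.mul_right hyy
      exact ⟨u - v, v, by linear_combination huv⟩
    obtain ⟨a, ha⟩ := Int.sq_of_gcd_eq_one (Int.isCoprime_iff_gcd_eq_one.mp hcop2) hz.symm
    obtain ⟨b, hb⟩ := Int.sq_of_gcd_eq_one
      (Int.isCoprime_iff_gcd_eq_one.mp hcop2.symm) ((mul_comm _ _).trans hz.symm)
    have hx2p : 0 < x ^ 2 := by positivity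
    have hy2p : 0 < y ^ 2 := by positivity
    have ha : x ^ 2 + y ^ 2 = a ^ 2 := by
      rcases ha with ha | ha
      · exact ha
      · nlinarith [sq_nonneg a]
    have hb : x ^ 2 + 9 * y ^ 2 = b ^ 2 := by
      rcases hb with hb | hb
      · exact hb
      · nlinarith [sq_nonneg b]
    have ha0 : 0 < |a| := by
      apply abs_pos.mpr; rintro rfl; linarith
    have hb0 : 0 < |b| := by
      apply abs_pos.mpr; rintro rfl; linarith
    have hc3 : IsCoprime x 3 := by
      obtain h | h : x % 3 = 1 ∨ x % 3 = 2 := by omega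
      · exact ⟨1, -(x / 3), by omega⟩
      · exact ⟨-1, (x / 3 + 1), by omega⟩
    have hcop3 : IsCoprime x (3 * y) := hc3.mul_right hcop
    rcases hpar with ⟨hx2, hy2⟩ | ⟨hx2, hy2⟩
    · -- x even
      have t1 : PythagoreanTriple y x |a| := by
        unfold PythagoreanTriple; rw [abs_mul_abs_self]; linarith
      have t2 : PythagoreanTriple (3 * y) x |b| := by
        unfold PythagoreanTriple; rw [abs_mul_abs_self]; linarith
      obtain ⟨m, n, hm1, hm2, -, -, hmp, -⟩ := t1.coprime_classification'
        (Int.isCoprime_iff_gcd_eq_one.mp hcop.symm) hy2 ha0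
      obtain ⟨p, q, hp1, hp2, -, -, hpp, -⟩ := t2.coprime_classification'
        (Int.isCoprime_iff_gcd_eq_one.mp hcop3.symm) (by omega) hb0
      have hm0 : m ≠ 0 := by rintro rfl; simp at hm2; omega
      obtain ⟨a', b', c', d', rfl, rfl, rfl, rfl⟩ := aux_four m n p q hm0 (by linarith)
      exact caseB a' b' c' d' hmp hpp (by linarith)
    · -- x odd
      have t1 : PythagoreanTriple x y |a| := by
        unfold PythagoreanTriple; rw [abs_mul_abs_self]; linarith
      have t2 : PythagoreanTriple x (3 * y) |b| := by
        unfold PythagoreanTriple; rw [abs_mul_abs_self]; linarith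
      obtain ⟨m, n, hm1, hm2, -, hmg, -, -⟩ := t1.coprime_classification'
        (Int.isCoprime_iff_gcd_eq_one.mp hcop) hx2 ha0
      obtain ⟨p, q, hp1, hp2, -, hpg, -, -⟩ := t2.coprime_classification'
        (Int.isCoprime_iff_gcd_eq_one.mp hcop3) hx2 hb0
      have hm0 : m ≠ 0 := by rintro rfl; simp at hm2; omega
      have hmn0 : m * n ≠ 0 := by
        intro h; rw [mul_assoc, h] at hm2; omega
      have hmc := Int.isCoprime_iff_gcd_eq_one.mpr hmg
      have hpc := Int.isCoprime_iff_gcd_eq_one.mpr hpg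
      have hpq : p * q = 3 * (m * n) := by linarith
      have h3 : (3 : ℤ) ∣ p ∨ (3 : ℤ) ∣ q := Int.prime_three.dvd_or_dvd ⟨_, hpq⟩
      have nb : ∀ r s : ℤ, IsCoprime r s → (3 : ℤ) ∣ r → (3 : ℤ) ∣ s → False := by
        intro r s hrs h1 h2
        have := hrs.isUnit_of_dvd' h1 h2
        rw [Int.isUnit_iff] at this
        omega
      rcases h3 with ⟨p', rfl⟩ | ⟨q', rfl⟩
      · obtain ⟨a', b', c', d', rfl, rfl, rfl, rfl⟩ := aux_four m n p' q hm0 (by linarith)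
        obtain ⟨k1, k2, -, -⟩ := aux_cop _ _ a' b' c' d' hmc rfl rfl
        obtain ⟨s1, s2, s3⟩ := size_lt x a' b' c' d' hx hmn0 y hm2 hy
        have hc0 : c' ≠ 0 := by rintro rfl; simp at hmn0
        obtain ⟨r1, r2⟩ := core d' c' b' a' k1.symm k2.symm hc0
          (fun h => nb _ _ hpc (Dvd.intro _ rfl) (h.mul_left _))
          (fun h => nb _ _ hpc (Dvd.intro _ rfl) (h.mul_right _))
          (by linear_combination hm1 - hp1)
        refine small |d'| |a'| (c' * b') s2 s1 (by linarith) ?_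
        rw [sq_abs, sq_abs, ← r1, ← r2]; ring
      · obtain ⟨a', b', c', d', rfl, rfl, rfl, rfl⟩ := aux_four m n p q' hm0 (by linarith)
        obtain ⟨k1, k2, -, -⟩ := aux_cop _ _ a' b' c' d' hmc rfl rfl
        obtain ⟨s1, s2, s3⟩ := size_lt x a' b' c' d' hx hmn0 y hm2 hy
        have hb0 : b' ≠ 0 := by rintro rfl; simp at hmn0
        obtain ⟨r1, r2⟩ := core a' b' c' d' k1 k2 hb0
          (fun h => nb _ _ hpc (h.mul_right _) (Dvd.intro _ rfl))
          (fun h => nb _ _ hpc (h.mul_left _) (Dvd.intro _ rfl))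
          (by linear_combination hp1 - hm1)
        refine small |a'| |d'| (b' * c') s1 s2 s3 ?_
        rw [sq_abs, sq_abs, ← r1, ← r2]; ring

theorem no_solution_z2_eq_x4_10x2y2_9y4 :
    ¬ ∃ x y z : ℕ, 0 < x ∧ 0 < y ∧ 0 < z ∧
      z ^ 2 = x ^ 4 + 10 * x ^ 2 * y ^ 2 + 9 * y ^ 4 := by
  rintro ⟨x, y, z, hx, hy, -, h⟩
  refine descent (x * y) x y z (by exact_mod_cast hx) (by exact_mod_cast hy) (by push_cast; rfl) ?_
  have h' : (z : ℤ) ^ 2 = x ^ 4 + 10 * x ^ 2 * y ^ 2 + 9 * y ^ 4 := by exact_mod_cast h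
  rw [h']; ring
end

section
/- If coprime positive integers A, B and a positive integer w satisfy w^2 = 2B^2 + A^2 with B even, then there exist coprime positive integers m, n such that A = |m^2 - 2n^2| and B = 2mn. -/
lemma sq_pos_aux (x y c : ℤ) (hx : 0 < x) (h : IsCoprime x y) (e : x * y = c ^ 2) :
    ∃ m : ℤ, 0 < m ∧ x = m ^ 2 := by
  obtain ⟨m, hm | hm⟩ := Int.sq_of_isCoprime h e
  · refine ⟨|m|, ?_, by rw [sq_abs]; exact hm⟩
    rw [abs_pos]
    rintro rfl
    simp at hm
    omega
  · nlinarith [sq_nonneg m]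

lemma split_aux (x y b : ℤ) (hx : 0 < x) (hy : 0 < y) (hb : 0 < b) (h : IsCoprime x y)
    (e : x * y = b ^ 2) :
    ∃ m n : ℤ, 0 < m ∧ 0 < n ∧ IsCoprime m n ∧ x = m ^ 2 ∧ y = n ^ 2 ∧ b = m * n := by
  obtain ⟨m, hm, rfl⟩ := sq_pos_aux x y b hx h e
  obtain ⟨n, hn, rfl⟩ := sq_pos_aux y _ b hy h.symm (by rw [mul_comm]; exact e)
  refine ⟨m, n, hm, hn, ?_, rfl, rfl, ?_⟩
  · exact (IsCoprime.pow_iff (by norm_num) (by norm_num)).1 h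
  · have h2 : (m * n) ^ 2 = b ^ 2 := by rw [← e]; ring
    have := mul_pos hm hn
    exact ((pow_left_inj₀ this.le hb.le (by norm_num)).1 h2).symm

theorem pell_like_parametrization (A B w : ℤ) (hA : 0 < A) (hB : 0 < B) (hw : 0 < w)
    (hcop : IsCoprime A B) (hBeven : Even B)
    (heq : w ^ 2 = 2 * B ^ 2 + A ^ 2) :
    ∃ m n : ℤ, 0 < m ∧ 0 < n ∧ IsCoprime m n ∧
      A = |m ^ 2 - 2 * n ^ 2| ∧ B = 2 * m * n := by
  obtain ⟨b, hb⟩ := hBeven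
  obtain rfl : B = 2 * b := by omega
  have hb0 : 0 < b := by omega
  have hwA : Even (w - A) := by
    have h1 : Even (w ^ 2 - A ^ 2) := ⟨4 * b ^ 2, by rw [heq]; ring⟩
    simpa [Int.even_sub, Int.even_pow] using h1
  obtain ⟨s, hs⟩ := hwA
  have hlt : A < w := by nlinarith [pow_pos hb0 2]
  have hs0 : 0 < s := by omega
  obtain ⟨t, rfl⟩ : ∃ t, A = t - s := ⟨A + s, by ring⟩
  obtain rfl : w = t + s := by omega
  have hst : s * t = 2 * b ^ 2 := by nlinarith
  have ht0 : 0 < t := by omega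
  have hc1 : IsCoprime (t - s) (s * t) := by
    rw [hst, show 2 * b ^ 2 = (2 * b) * b by ring]
    exact hcop.mul_right hcop.of_mul_right_right
  have hc : IsCoprime t s := by
    have := hc1.of_mul_right_left
    have h2 := this.add_mul_left_left 1
    simpa using h2
  have hev : Even (s * t) := ⟨b ^ 2, by rw [hst]; ring⟩
  rcases Int.even_mul.1 hev with h | h
  · obtain ⟨r, hr⟩ := h
    obtain rfl : s = 2 * r := by omega
    obtain ⟨m, n, hm, hn, hmn, rfl, rfl, rfl⟩ := split_aux t r b ht0 (by omega) hb0
      hc.of_mul_right_right (by linarith)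
    exact ⟨m, n, hm, hn, hmn, (abs_of_pos hA).symm, by ring⟩
  · obtain ⟨r, hr⟩ := h
    obtain rfl : t = 2 * r := by omega
    obtain ⟨m, n, hm, hn, hmn, rfl, rfl, rfl⟩ := split_aux s r b hs0 (by omega) hb0
      hc.symm.of_mul_right_right (by linarith)
    exact ⟨m, n, hm, hn, hmn, by rw [abs_sub_comm]; exact (abs_of_pos hA).symm, by ring⟩
end
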